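/- For every p ∈ (0,1), the centered rate function z ↦ J(p,z) is not even: there exists z ∈ (0, −ln(p)) such that J(p,−z) ≠ J(p,z). -/

import Mathlib

/-- The centered rate function `J_p(z)` (as a function of the tail probability `p`
and `z`), with the convention `0 * log 0 = 0` (automatic since `Real.log 0 = 0`). -/
noncomputable def Jfun (p z : ℝ) : ℝ :=
  -z * p * Real.exp (-z) +
    (1 - p * Real.exp (-z)) * Real.log ((1 - p * Real.exp (-z)) / (1 - p))

theorem hasDerivAt_Jfun {p z : ℝ} (hp : p < 1) (hz : p * Real.exp (-z) < 1) :
    HasDerivAt (Jfun p)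
      (p * Real.exp (-z) * (z + Real.log ((1 - p * Real.exp (-z)) / (1 - p)))) z := by
  have h1 : 1 - p ≠ 0 := by linarith
  have h2 : 1 - p * Real.exp (-z) ≠ 0 := by linarith
  have hexp : HasDerivAt (fun t : ℝ => Real.exp (-t)) (Real.exp (-z) * -1) z :=
    (hasDerivAt_id z).neg.exp
  have hsub := (hexp.const_mul p).const_sub 1
  have hlog := (hsub.div_const (1 - p)).log (div_ne_zero h2 h1)
  have hlin := ((hasDerivAt_id z).neg.mul_const p).mul hexp
  refine (hlin.add (hsub.mul hlog)).congr_deriv ?_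
  simp only [Pi.neg_apply, id]
  field_simp
  ring

theorem deriv_Jfun_le {p z : ℝ} (hp₀ : 0 < p) (hp₁ : p < 1) (hz : p * Real.exp (-z) < 1) :
    p * Real.exp (-z) * (z + Real.log ((1 - p * Real.exp (-z)) / (1 - p))) ≤
      p / (1 - p) * (1 - Real.exp (-z)) := by
  have h1 : 0 < 1 - p := by linarith
  have h2 : 0 < (1 - p * Real.exp (-z)) / (1 - p) := div_pos (by linarith) h1
  have hcancel : Real.exp (-z) * Real.exp z = 1 := by rw [← Real.exp_add]; simp
  have hlog := Real.log_le_sub_one_of_pos (mul_pos (Real.exp_pos z) h2)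
  rw [Real.log_mul (Real.exp_ne_zero z) h2.ne', Real.log_exp] at hlog
  refine (mul_le_mul_of_nonneg_left hlog (by positivity)).trans_eq ?_
  field_simp
  linear_combination (1 - p * Real.exp (-z)) * hcancel

theorem stmt15 (p : ℝ) (hp : p ∈ Set.Ioo (0:ℝ) 1) :
    ∃ z ∈ Set.Ioo (0:ℝ) (-Real.log p), Jfun p (-z) ≠ Jfun p z := by
  obtain ⟨hp₀, hp₁⟩ := hp
  by_contra! heven
  have hlogp := Real.log_neg hp₀ hp₁
  obtain ⟨z, hz₀, hz₁⟩ := exists_between (neg_pos.mpr hlogp)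
  have hneg : p * Real.exp (-z) < 1 := by
    have := Real.exp_lt_one_iff.mpr (neg_lt_zero.mpr hz₀)
    nlinarith
  have hpos : p * Real.exp (-(-z)) < 1 := by
    rw [neg_neg, ← Real.exp_log hp₀, ← Real.exp_add, Real.exp_lt_one_iff]
    linarith
  have hJ := hasDerivAt_Jfun hp₁ hneg
  have hJneg := (hasDerivAt_Jfun hp₁ hpos).scomp z (hasDerivAt_neg z)
  have heq : Jfun p =ᶠ[nhds z] Jfun p ∘ Neg.neg := by
    filter_upwards [Ioo_mem_nhds hz₀ hz₁] with t ht using (heven t ht).symm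
  have hderiv := hJ.unique (hJneg.congr_of_eventuallyEq heq)
  simp only [smul_eq_mul] at hderiv
  have hle := deriv_Jfun_le hp₀ hp₁ hneg
  have hle' := deriv_Jfun_le hp₀ hp₁ hpos
  have hodd : 0 < p / (1 - p) * (Real.exp (-z) + Real.exp (-(-z)) - 2) := by
    refine mul_pos (div_pos hp₀ (by linarith)) ?_
    have h1 := Real.add_one_lt_exp (neg_ne_zero.mpr hz₀.ne')
    have h2 := Real.add_one_lt_exp (neg_ne_zero.mpr (neg_ne_zero.mpr hz₀.ne'))
    linarith
  linarith
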